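/- arXiv:2605.00947 — 3 statements merged into one kernel-verified Lean document; each statement's English description precedes it below -/
import Mathlib

section
/- Let A ∈ ℝ^{n×n} and let v_1, ..., v_N ∈ ℝⁿ be linearly independent eigenvectors of A for real eigenvalues ρ_1, ..., ρ_N respectively. Then for every ε > 0 there exists δ > 0 such that: whenever w_1, ..., w_N ∈ ℝⁿ satisfy ‖v_j − w_j‖ < δ for all j, there exists a matrix Ã ∈ ℝ^{n×n} with ‖A − Ã‖ < ε whose characteristic polynomial equals that of A (so Ã has the same eigenvalues as A counted with algebraic multiplicity) and which satisfies Ã w_j = ρ_j w_j for all j ∈ {1,...,N}. -/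
attribute [local instance] Matrix.linftyOpNormedAddCommGroup

/-- Linearly independent vectors have a dual family, given as the rows of a matrix. -/
theorem LinearIndependent.exists_matrix_mulVec_eq_single {n N : ℕ} {v : Fin N → Fin n → ℝ}
    (hind : LinearIndependent ℝ v) :
    ∃ L : Matrix (Fin N) (Fin n) ℝ, ∀ j, L.mulVec (v j) = Pi.single j 1 := by
  obtain ⟨g, hg⟩ := LinearMap.exists_leftInverse_of_injective (Fintype.linearCombination ℝ v)
    (LinearMap.ker_eq_bot.2 hind.fintypeLinearCombination_injective)
  refine ⟨LinearMap.toMatrix' g, fun j => ?_⟩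
  have h := LinearMap.congr_fun hg (Pi.single j 1)
  simpa [Fintype.linearCombination_apply_single] using h

/-- Conjugation by invertible matrices is continuous at the identity. -/
theorem Matrix.continuousAt_conj_one {n : ℕ} (A : Matrix (Fin n) (Fin n) ℝ) :
    ContinuousAt (fun S : Matrix (Fin n) (Fin n) ℝ => S * A * S⁻¹) 1 := by
  have hdet : ContinuousAt (fun S : Matrix (Fin n) (Fin n) ℝ => S.det) 1 :=
    continuous_id.matrix_det.continuousAt
  have hadj : ContinuousAt (fun S : Matrix (Fin n) (Fin n) ℝ => S.adjugate) 1 :=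
    continuous_id.matrix_adjugate.continuousAt
  have hinv : ContinuousAt (fun S : Matrix (Fin n) (Fin n) ℝ => S⁻¹) 1 := by
    simp only [Matrix.inv_def, Ring.inverse_eq_inv']
    exact (hdet.inv₀ (by simp)).smul hadj
  exact (continuousAt_id.mul continuousAt_const).mul hinv

/-- Eigenvector perturbation: if `v 0, …, v (N-1)` are linearly independent eigenvectors
of `A` for real eigenvalues `ρ j`, then for every `ε > 0` there is a `δ > 0` such that
any vectors `w j` that are `δ`-close to the `v j` are eigenvectors, for the same
eigenvalues, of some matrix `Ã` that is `ε`-close to `A` and has the same characteristic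
polynomial as `A`. -/
theorem eigenvector_perturbation
    (n N : ℕ) (A : Matrix (Fin n) (Fin n) ℝ)
    (v : Fin N → Fin n → ℝ) (hind : LinearIndependent ℝ v)
    (ρ : Fin N → ℝ) (hv : ∀ j, A.mulVec (v j) = ρ j • v j) :
    ∀ ε > 0, ∃ δ > 0, ∀ w : Fin N → Fin n → ℝ, (∀ j, ‖v j - w j‖ < δ) →
      ∃ Atld : Matrix (Fin n) (Fin n) ℝ, ‖A - Atld‖ < ε ∧
        Matrix.charpoly Atld = Matrix.charpoly A ∧
        ∀ j, Atld.mulVec (w j) = ρ j • w j := by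
  intro ε hε
  obtain ⟨L, hL⟩ := hind.exists_matrix_mulVec_eq_single
  let S : (Fin N → Fin n → ℝ) → Matrix (Fin n) (Fin n) ℝ :=
    fun w => 1 + (Matrix.of (w - v)).transpose * L
  have hSv : S v = 1 := by
    have h0 : Matrix.of (0 : Fin N → Fin n → ℝ) = 0 := rfl
    simp [S, h0]
  have hS : Continuous S := by
    have h : Continuous fun w : Fin N → Fin n → ℝ => Matrix.of (w - v) :=
      continuous_id.sub continuous_const
    exact continuous_const.add (h.matrix_transpose.matrix_mul continuous_const)
  have hSw (w : Fin N → Fin n → ℝ) (j : Fin N) : (S w).mulVec (v j) = w j := by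
    simp only [S, Matrix.add_mulVec, Matrix.one_mulVec, ← Matrix.mulVec_mulVec, hL,
      Matrix.mulVec_single_one]
    ext i
    simp [Matrix.col]
  have hconj : ContinuousAt (fun w => S w * A * (S w)⁻¹) v :=
    ContinuousAt.comp (f := S) (g := fun T : Matrix (Fin n) (Fin n) ℝ => T * A * T⁻¹)
      (by rw [hSv]; exact Matrix.continuousAt_conj_one A) hS.continuousAt
  have hnear : ∀ᶠ w in nhds v, ‖A - S w * A * (S w)⁻¹‖ < ε := by
    have h : ContinuousAt (fun w => ‖A - S w * A * (S w)⁻¹‖) v :=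
      (continuousAt_const.sub hconj).norm
    exact h.eventually (gt_mem_nhds (by simpa [hSv] using hε))
  have hdet : ∀ᶠ w in nhds v, (S w).det ≠ 0 :=
    hS.matrix_det.continuousAt.eventually_ne (by simp [hSv])
  obtain ⟨δ, hδ, hball⟩ := Metric.eventually_nhds_iff.1 (hnear.and hdet)
  refine ⟨δ, hδ, fun w hw => ?_⟩
  obtain ⟨hlt, hne⟩ := hball (y := w) (by
    rw [dist_comm, dist_pi_lt_iff hδ]
    exact fun j => by simpa [dist_eq_norm] using hw j)
  have hunit : IsUnit (S w).det := hne.isUnit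
  refine ⟨S w * A * (S w)⁻¹, hlt, ?_, fun j => ?_⟩
  · rw [Matrix.charpoly_mul_comm, ← Matrix.mul_assoc, Matrix.nonsing_inv_mul _ hunit,
      Matrix.one_mul]
  · calc (S w * A * (S w)⁻¹).mulVec (w j)
        = (S w * A * (S w)⁻¹).mulVec ((S w).mulVec (v j)) := by rw [hSw]
      _ = (S w).mulVec (A.mulVec (v j)) := by
        rw [Matrix.mulVec_mulVec, Matrix.mul_assoc, Matrix.nonsing_inv_mul _ hunit,
          Matrix.mul_one, Matrix.mulVec_mulVec]
      _ = ρ j • w j := by rw [hv, Matrix.mulVec_smul, hSw]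
end

section
/- Let A ∈ ℝ^{n×n}, b ∈ ℝⁿ, B ∈ ℝ^{m×n}, η ∈ ℝ^m, and let f(x) = A x + b. Define the homogenised matrices Â ∈ ℝ^{(n+1)×(n+1)} with block form (A, b; 0, 1) and B̂ ∈ ℝ^{(m+1)×(n+1)} with block form (B, −η; 0, 1). Then (A, b, B, η) lies in the topological interior (within ℝ^{n×n} × ℝⁿ × ℝ^{m×n} × ℝ^m) of the set of escaping affine instances if and only if: for every real eigenvalue λ ≥ 1 of Â and every v̂ ∈ ℝ^{n+1} with ‖v̂‖ = 1 and Â v̂ = λ v̂, there exists j ∈ {1,...,m+1} with B̂_j v̂ < 0. -/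
/-- The homogenisation `Â = (A, b; 0, 1)` of the affine map `x ↦ A x + b`. -/
def hatA {n : ℕ} (A : Matrix (Fin n) (Fin n) ℝ) (b : Fin n → ℝ) :
    Matrix (Fin (n + 1)) (Fin (n + 1)) ℝ :=
  Matrix.of fun i j =>
    if hi : (i : ℕ) < n then
      if hj : (j : ℕ) < n then A ⟨i, hi⟩ ⟨j, hj⟩ else b ⟨i, hi⟩
    else
      if (j : ℕ) < n then 0 else 1

/-- The homogenisation `B̂ = (B, -η; 0, 1)` of the affine constraints `B x ⊳ η`. -/
def hatB {m n : ℕ} (B : Matrix (Fin m) (Fin n) ℝ) (η : Fin m → ℝ) :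
    Matrix (Fin (m + 1)) (Fin (n + 1)) ℝ :=
  Matrix.of fun i j =>
    if hi : (i : ℕ) < m then
      if hj : (j : ℕ) < n then B ⟨i, hi⟩ ⟨j, hj⟩ else -η ⟨i, hi⟩
    else
      if (j : ℕ) < n then 0 else 1

/-- The affine instance `(A, b, B, η)` is trapped if some point of the polyhedron
`P(B, η) = {x : B x ⊳ η}` stays in `P(B, η)` forever under iteration of
`f(x) = A x + b`. -/
def IsTrappedAff {n m : ℕ} (A : Matrix (Fin n) (Fin n) ℝ) (b : Fin n → ℝ)
    (B : Matrix (Fin m) (Fin n) ℝ) (η : Fin m → ℝ) : Prop :=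
  ∃ x : Fin n → ℝ, ∀ k : ℕ, ∀ j : Fin m,
    η j < B.mulVec ((fun y => A.mulVec y + b)^[k] x) j

open Filter Topology

section Cone

variable {E : Type*} [NormedAddCommGroup E] [NormedSpace ℝ E]

/-- If `S` maps onto a closed cone from within the cone, with a bounded selection of preimages,
then so does `S - N` for a sufficiently small perturbation `N` preserving the cone. -/
theorem PointedCone.exists_preimage_sub [CompleteSpace E] {C : PointedCone ℝ E}
    (hC : IsClosed (C : Set E)) {S N : E →L[ℝ] E} (hN : ∀ y ∈ C, N y ∈ C) {δ a : ℝ}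
    (ha : 0 ≤ a) (had : a < δ) (hS : ∀ y ∈ C, δ * ‖y‖ ≤ ‖S y‖)
    (hNa : ∀ y, ‖N y‖ ≤ a * ‖y‖) (hsurj : ∀ c ∈ C, ∃ y ∈ C, S y = c) :
    ∀ c ∈ C, ∃ y ∈ C, (S - N) y = c := by
  intro c hc
  have hδ : 0 < δ := ha.trans_lt had
  choose g hgC hgS using hsurj
  obtain ⟨u, hu0, hus⟩ : ∃ u : ℕ → C, S (u 0 : E) = c ∧
      ∀ k, S (u (k + 1) : E) = N (u k : E) := by
    refine ⟨fun k => (fun y : C => (⟨g (N y) (hN y y.2), hgC _ _⟩ : C))^[k] ⟨g c hc, hgC c hc⟩,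
      hgS c hc, fun k => ?_⟩
    simp only [Function.iterate_succ_apply', hgS]
  have hr : a / δ < 1 := (div_lt_one hδ).2 had
  have hbound (k : ℕ) : ‖(u (k + 1) : E)‖ ≤ a / δ * ‖(u k : E)‖ := by
    have h1 := hS _ (u (k + 1)).2
    rw [hus] at h1
    have h2 := h1.trans (hNa (u k))
    rw [div_mul_eq_mul_div, le_div_iff₀ hδ]
    linarith
  have hsum : Summable (fun k => (u k : E)) := by
    refine summable_of_ratio_norm_eventually_le hr (Eventually.of_forall hbound)
  refine ⟨∑' k, (u k : E), ?_, ?_⟩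
  · exact hC.mem_of_tendsto hsum.hasSum.tendsto_sum_nat
      (Eventually.of_forall fun n => Submodule.sum_mem C fun k _ => (u k).2)
  · have h1 : S (∑' k, (u k : E)) = c + N (∑' k, (u k : E)) := by
      rw [S.map_tsum hsum, N.map_tsum hsum, Summable.tsum_eq_zero_add (f := fun k => S (u k : E)) (hsum.map S S.continuous)]
      simp [hu0, hus]
    simp [h1]

/-- A Perron-Frobenius type theorem: a linear map preserving a closed cone and a functional which
does not vanish on the cone has an eigenvector in the cone for some eigenvalue `μ⁻¹ ≥ 1`. -/
theorem PointedCone.exists_norm_eq_one_eq_smul [FiniteDimensional ℝ E] {C : PointedCone ℝ E}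
    (hC : IsClosed (C : Set E)) (T : E →L[ℝ] E) (hT : ∀ y ∈ C, T y ∈ C) (φ : E →ₗ[ℝ] ℝ)
    (hφ : ∀ y, φ (T y) = φ y) {x : E} (hx : x ∈ C) (hφx : φ x ≠ 0) :
    ∃ μ ∈ Set.Icc (0 : ℝ) 1, ∃ v ∈ C, ‖v‖ = 1 ∧ v = μ • T v := by
  by_contra! hne
  have := FiniteDimensional.complete ℝ E
  have := FiniteDimensional.proper ℝ E
  have hK : IsCompact (Set.Icc (0 : ℝ) 1 ×ˢ ((C : Set E) ∩ Metric.sphere 0 1)) :=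
    isCompact_Icc.prod ((isCompact_sphere 0 1).inter_left hC)
  obtain ⟨δ, hδ, hδK⟩ : ∃ δ : ℝ, 0 < δ ∧
      ∀ p ∈ Set.Icc (0 : ℝ) 1 ×ˢ ((C : Set E) ∩ Metric.sphere 0 1), δ ≤ ‖p.2 - p.1 • T p.2‖ := by
    refine hK.exists_forall_le' (f := fun p : ℝ × E => ‖p.2 - p.1 • T p.2‖) (by fun_prop) ?_
    rintro ⟨μ, v⟩ ⟨hμ, hv, hv1⟩
    exact norm_pos_iff.2 (sub_ne_zero.2 (hne μ hμ v hv (by simpa using hv1)))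
  have hlow : ∀ μ ∈ Set.Icc (0 : ℝ) 1, ∀ y ∈ C,
      δ * ‖y‖ ≤ ‖(ContinuousLinearMap.id ℝ E - μ • T) y‖ := by
    intro μ hμ y hy
    rcases eq_or_ne y 0 with rfl | hy0
    · simp
    have hn : 0 < ‖y‖ := norm_pos_iff.2 hy0
    have h := hδK (μ, ‖y‖⁻¹ • y) ⟨hμ, C.smul_mem (by positivity) hy, by simp [norm_smul, hn.ne']⟩
    have heq : ‖y‖⁻¹ • y - μ • T (‖y‖⁻¹ • y)
        = ‖y‖⁻¹ • (ContinuousLinearMap.id ℝ E - μ • T) y := by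
      simp [smul_sub, smul_comm μ]
    simp only [heq, norm_smul, norm_inv, norm_norm] at h
    rwa [inv_mul_eq_div, le_div_iff₀ hn] at h
  obtain ⟨h, hh, hhT⟩ : ∃ h : ℝ, 0 < h ∧ h * ‖T‖ < δ := by
    refine ⟨δ / (‖T‖ + 1), by positivity, ?_⟩
    rw [div_mul_eq_mul_div, div_lt_iff₀ (by positivity)]
    nlinarith [norm_nonneg T]
  have hstep (k : ℕ) : ∀ c ∈ C, ∃ y ∈ C,
      (ContinuousLinearMap.id ℝ E - min (k * h) 1 • T) y = c := by
    induction k with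
    | zero => intro c hc; exact ⟨c, hc, by simp⟩
    | succ k ih =>
      set μ := min (k * h) 1 with hμ
      set ν := min ((k + 1 : ℕ) * h) 1 with hν
      have hkh : (0 : ℝ) ≤ k * h := by positivity
      have hμ01 : μ ∈ Set.Icc (0 : ℝ) 1 := ⟨le_min hkh zero_le_one, min_le_right _ _⟩
      have hle : μ ≤ ν := min_le_min_right _ (by push_cast; linarith)
      have hνle : ν ≤ μ + h := by
        rw [hμ, hν, ← min_add_add_right]
        exact min_le_min (by push_cast; linarith) (by linarith)
      have hdiff : ContinuousLinearMap.id ℝ E - ν • T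
          = (ContinuousLinearMap.id ℝ E - μ • T) - (ν - μ) • T := by
        rw [sub_smul]; abel
      rw [hdiff]
      refine PointedCone.exists_preimage_sub hC
        (fun y hy => C.smul_mem (sub_nonneg.2 hle) (hT y hy))
        (a := h * ‖T‖) (by positivity) hhT (hlow μ hμ01) (fun y => ?_) ih
      simp only [_root_.smul_apply, norm_smul, Real.norm_eq_abs,
        abs_of_nonneg (sub_nonneg.2 hle), mul_assoc]
      gcongr
      · linarith
      · exact T.le_opNorm y
  obtain ⟨k, hk⟩ := exists_nat_ge (1 / h)
  obtain ⟨y, -, hy⟩ := hstep k x hx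
  rw [div_le_iff₀ hh] at hk
  rw [min_eq_right hk] at hy
  apply hφx
  rw [← hy]
  simp [hφ]

end Cone

section Homogenisation

variable {n m : ℕ} (A : Matrix (Fin n) (Fin n) ℝ) (b : Fin n → ℝ)
  (B : Matrix (Fin m) (Fin n) ℝ) (η : Fin m → ℝ)

theorem hatA_mulVec_castSucc (v : Fin (n + 1) → ℝ) (i : Fin n) :
    (hatA A b).mulVec v i.castSucc = A.mulVec (Fin.init v) i + b i * v (Fin.last n) := by
  simp [hatA, Matrix.mulVec, dotProduct, Fin.sum_univ_castSucc, Fin.init]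

theorem hatA_mulVec_last (v : Fin (n + 1) → ℝ) :
    (hatA A b).mulVec v (Fin.last n) = v (Fin.last n) := by
  simp [hatA, Matrix.mulVec, dotProduct, Fin.sum_univ_castSucc]

theorem hatB_mulVec_castSucc (v : Fin (n + 1) → ℝ) (j : Fin m) :
    (hatB B η).mulVec v j.castSucc = B.mulVec (Fin.init v) j - η j * v (Fin.last n) := by
  simp [hatB, Matrix.mulVec, dotProduct, Fin.sum_univ_castSucc, Fin.init, sub_eq_add_neg]

theorem hatB_mulVec_last (v : Fin (n + 1) → ℝ) :
    (hatB B η).mulVec v (Fin.last m) = v (Fin.last n) := by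
  simp [hatB, Matrix.mulVec, dotProduct, Fin.sum_univ_castSucc]

theorem hatA_mulVec_snoc_one (x : Fin n → ℝ) :
    (hatA A b).mulVec (Fin.snoc x 1) = Fin.snoc (A.mulVec x + b) 1 := by
  ext i
  induction i using Fin.lastCases with
  | last => simp [hatA_mulVec_last]
  | cast i => simp [hatA_mulVec_castSucc]

theorem hatA_pow_mulVec_snoc_one (x : Fin n → ℝ) (k : ℕ) :
    (hatA A b ^ k).mulVec (Fin.snoc x 1)
      = Fin.snoc ((fun y => A.mulVec y + b)^[k] x) 1 := by
  induction k with
  | zero => simp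
  | succ k ih =>
    rw [pow_succ', ← Matrix.mulVec_mulVec, ih, hatA_mulVec_snoc_one,
      Function.iterate_succ_apply']

/-- The cone of vectors all of whose images under powers of `M` satisfy `D y ≥ 0`. -/
def invariantCone {ι κ : Type*} [Fintype ι] [DecidableEq ι] (M : Matrix ι ι ℝ)
    (D : Matrix κ ι ℝ) : PointedCone ℝ (ι → ℝ) where
  carrier := {y | ∀ k : ℕ, 0 ≤ D.mulVec ((M ^ k).mulVec y)}
  add_mem' hx hy k := by
    rw [Matrix.mulVec_add, Matrix.mulVec_add]
    exact add_nonneg (hx k) (hy k)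
  zero_mem' k := by simp
  smul_mem' c x hx k := by
    have : c • x = (c : ℝ) • x := rfl
    rw [this, Matrix.mulVec_smul, Matrix.mulVec_smul]
    exact smul_nonneg c.2 (hx k)

theorem isClosed_invariantCone {ι κ : Type*} [Fintype ι] [DecidableEq ι] (M : Matrix ι ι ℝ)
    (D : Matrix κ ι ℝ) : IsClosed (invariantCone M D : Set (ι → ℝ)) := by
  have : (invariantCone M D : Set (ι → ℝ))
      = ⋂ k : ℕ, {y | 0 ≤ D.mulVec ((M ^ k).mulVec y)} := by
    ext y; simp [invariantCone]
  rw [this]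
  exact isClosed_iInter fun k => isClosed_le continuous_const (by fun_prop)

theorem mulVec_mem_invariantCone {ι κ : Type*} [Fintype ι] [DecidableEq ι] {M : Matrix ι ι ℝ}
    {D : Matrix κ ι ℝ} {y : ι → ℝ} (hy : y ∈ invariantCone M D) :
    M.mulVec y ∈ invariantCone M D := fun k => by
  rw [Matrix.mulVec_mulVec y, ← pow_succ]
  exact hy (k + 1)

variable {A b B η}

theorem IsTrappedAff.exists_eq_smul_hatA_mulVec (h : IsTrappedAff A b B η) :
    ∃ μ ∈ Set.Icc (0 : ℝ) 1, ∃ v : Fin (n + 1) → ℝ, ‖v‖ = 1 ∧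
      v = μ • (hatA A b).mulVec v ∧ 0 ≤ (hatB B η).mulVec v := by
  obtain ⟨x, hx⟩ := h
  have hxC : (Fin.snoc x 1 : Fin (n + 1) → ℝ) ∈ invariantCone (hatA A b) (hatB B η) := by
    intro k j
    rw [hatA_pow_mulVec_snoc_one]
    induction j using Fin.lastCases with
    | last => simp [hatB_mulVec_last]
    | cast j => simpa [hatB_mulVec_castSucc] using (hx k j).le
  obtain ⟨μ, hμ, v, hv, hv1, hvμ⟩ := PointedCone.exists_norm_eq_one_eq_smul
    (isClosed_invariantCone _ _) (hatA A b).mulVecLin.toContinuousLinearMap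
    (fun y hy => mulVec_mem_invariantCone hy) (LinearMap.proj (Fin.last n))
    (fun y => hatA_mulVec_last A b y) hxC (by simp)
  exact ⟨μ, hμ, v, hv1, hvμ, by simpa using hv 0⟩

theorem Continuous.hatA {X : Type*} [TopologicalSpace X] {f : X → Matrix (Fin n) (Fin n) ℝ}
    {g : X → Fin n → ℝ} (hf : Continuous f) (hg : Continuous g) :
    Continuous fun x => hatA (f x) (g x) := by
  refine continuous_matrix fun i j => ?_
  simp only [_root_.hatA, Matrix.of_apply]
  split_ifs <;> fun_prop

theorem Continuous.hatB {X : Type*} [TopologicalSpace X] {f : X → Matrix (Fin m) (Fin n) ℝ}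
    {g : X → Fin m → ℝ} (hf : Continuous f) (hg : Continuous g) :
    Continuous fun x => hatB (f x) (g x) := by
  refine continuous_matrix fun i j => ?_
  simp only [_root_.hatB, Matrix.of_apply]
  split_ifs <;> fun_prop

theorem isClosed_setOf_exists_eq_smul_hatA_mulVec (n m : ℕ) :
    IsClosed {q : Matrix (Fin n) (Fin n) ℝ × (Fin n → ℝ) ×
        Matrix (Fin m) (Fin n) ℝ × (Fin m → ℝ) |
      ∃ μ ∈ Set.Icc (0 : ℝ) 1, ∃ v : Fin (n + 1) → ℝ, ‖v‖ = 1 ∧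
        v = μ • (hatA q.1 q.2.1).mulVec v ∧ 0 ≤ (hatB q.2.2.1 q.2.2.2).mulVec v} := by
  have hcl : IsClosed {p : ((Set.Icc (0 : ℝ) 1) × Metric.sphere (0 : Fin (n + 1) → ℝ) 1) ×
      (Matrix (Fin n) (Fin n) ℝ × (Fin n → ℝ) × Matrix (Fin m) (Fin n) ℝ × (Fin m → ℝ)) |
      (p.1.2 : Fin (n + 1) → ℝ) = (p.1.1 : ℝ) • (hatA p.2.1 p.2.2.1).mulVec p.1.2 ∧
        0 ≤ (hatB p.2.2.2.1 p.2.2.2.2).mulVec p.1.2} := by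
    refine IsClosed.inter (isClosed_eq ?_ (Continuous.fun_smul ?_
      (Continuous.matrix_mulVec (Continuous.hatA ?_ ?_) ?_)))
      (isClosed_le continuous_const (Continuous.matrix_mulVec (Continuous.hatB ?_ ?_) ?_)) <;>
    fun_prop
  have hclosed := isClosedMap_snd_of_compactSpace _ hcl
  convert hclosed using 1
  ext q
  constructor
  · rintro ⟨μ, hμ, v, hv1, hv⟩
    exact ⟨((⟨μ, hμ⟩, ⟨v, by simpa using hv1⟩), q), hv, rfl⟩
  · rintro ⟨⟨⟨μ, v⟩, q⟩, hv, rfl⟩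
    exact ⟨μ, μ.2, v, by simp, hv⟩

theorem isTrappedAff_of_fixedPoint {x : Fin n → ℝ} (hx : A.mulVec x + b = x)
    (hxB : ∀ j, η j < B.mulVec x j) : IsTrappedAff A b B η := by
  refine ⟨x, fun k j => ?_⟩
  rw [Function.iterate_fixed hx]
  exact hxB j

theorem isTrappedAff_of_eigenvector {lam : ℝ} (hlam : 1 ≤ lam) {v : Fin n → ℝ}
    (hv : A.mulVec v = lam • v) (hBv : ∀ j, 0 < B.mulVec v j) (hdet : (A - 1).det ≠ 0) :
    IsTrappedAff A b B η := by
  obtain ⟨p, hp⟩ := (Matrix.mulVec_surjective_iff_isUnit.2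
    ((Matrix.isUnit_iff_isUnit_det _).2 hdet.isUnit)) (-b)
  have hfix : A.mulVec p + b = p := by
    rw [Matrix.sub_mulVec, Matrix.one_mulVec, sub_eq_iff_eq_add] at hp
    rw [hp]; abel
  obtain ⟨s, hs0, hs⟩ : ∃ s : ℝ, 0 ≤ s ∧ ∀ j, η j < B.mulVec p j + s * B.mulVec v j := by
    have : ∀ᶠ s : ℝ in atTop, 0 ≤ s ∧ ∀ j, η j < B.mulVec p j + s * B.mulVec v j :=
      (eventually_ge_atTop 0).and (eventually_all.2 fun j =>
        (tendsto_atTop_add_const_left _ _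
          (tendsto_id.atTop_mul_const (hBv j))).eventually_gt_atTop _)
    exact this.exists
  have hiter (k : ℕ) : (fun y => A.mulVec y + b)^[k] (p + s • v) = p + (lam ^ k * s) • v := by
    induction k with
    | zero => simp
    | succ k ih =>
      rw [Function.iterate_succ_apply', ih]
      simp only [Matrix.mulVec_add, Matrix.mulVec_smul, hv]
      rw [add_right_comm, hfix, smul_smul]
      congr 2
      ring
  refine ⟨p + s • v, fun k j => ?_⟩
  rw [hiter, Matrix.mulVec_add, Matrix.mulVec_smul]
  refine (hs j).trans_le ?_
  simp only [Pi.add_apply, Pi.smul_apply, smul_eq_mul]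
  have := hBv j
  gcongr
  exact le_mul_of_one_le_left hs0 (one_le_pow₀ hlam)

theorem eventually_det_add_smul_one_sub_one_ne_zero (A : Matrix (Fin n) (Fin n) ℝ) :
    ∀ᶠ ε : ℝ in 𝓝[>] 0, (A + ε • (1 : Matrix (Fin n) (Fin n) ℝ) - 1).det ≠ 0 := by
  have hfin := Polynomial.finite_setOfPred_isRoot (Matrix.charpoly_monic (1 - A)).ne_zero
  have h : ∀ᶠ ε : ℝ in 𝓝[≠] 0, ε ∉ {x | (1 - A).charpoly.IsRoot x} := by
    have := (hfin.subset Set.sdiff_subset :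
      ({x | (1 - A).charpoly.IsRoot x} \ {0}).Finite).isClosed.isOpen_compl.mem_nhds
      (x := 0) (by simp)
    filter_upwards [nhdsWithin_le_nhds this, self_mem_nhdsWithin] with ε h1 h2 h3
    exact h1 ⟨h3, h2⟩
  filter_upwards [nhdsWithin_mono _ (fun x hx => ne_of_gt hx) h] with ε hε hdet
  apply hε
  rw [Polynomial.IsRoot.def, Matrix.eval_charpoly, ← hdet]
  congr 1
  rw [Matrix.scalar_apply, ← Matrix.smul_one_eq_diagonal]
  abel

theorem notMem_interior_of_eigenvector {lam : ℝ} (hlam : 1 ≤ lam) {v : Fin (n + 1) → ℝ}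
    (hv0 : v ≠ 0) (hv : (hatA A b).mulVec v = lam • v) (hBv : ∀ j, 0 ≤ (hatB B η).mulVec v j) :
    (A, b, B, η) ∉ interior {q : Matrix (Fin n) (Fin n) ℝ × (Fin n → ℝ) ×
        Matrix (Fin m) (Fin n) ℝ × (Fin m → ℝ) |
          ¬ IsTrappedAff q.1 q.2.1 q.2.2.1 q.2.2.2} := by
  intro hint
  rw [mem_interior_iff_mem_nhds] at hint
  have hA (i : Fin n) : A.mulVec (Fin.init v) i + b i * v (Fin.last n) = lam * v i.castSucc := by
    rw [← hatA_mulVec_castSucc, hv]; rfl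
  have hB (j : Fin m) : 0 ≤ B.mulVec (Fin.init v) j - η j * v (Fin.last n) := by
    rw [← hatB_mulVec_castSucc]; exact hBv _
  have ht : 0 ≤ v (Fin.last n) := by
    have := hBv (Fin.last m)
    rwa [hatB_mulVec_last] at this
  rcases ht.eq_or_lt with ht | ht
  · rw [← ht] at hA hB
    set w : Fin n → ℝ := Fin.init v with hw
    have hw0 : w ≠ 0 := by
      contrapose! hv0
      ext i
      induction i using Fin.lastCases with
      | last => exact ht.symm
      | cast i => exact congrFun hv0 i
    have hAw : A.mulVec w = lam • w := by
      ext i; simpa [hw, Fin.init] using hA i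
    have hcont : Continuous fun ε : ℝ =>
        ((A + ε • (1 : Matrix (Fin n) (Fin n) ℝ), b,
          B + ε • Matrix.vecMulVec (fun _ => (1 : ℝ)) w, η) :
          Matrix (Fin n) (Fin n) ℝ × (Fin n → ℝ) × Matrix (Fin m) (Fin n) ℝ × (Fin m → ℝ)) := by
      fun_prop
    have h0 := hcont.tendsto 0
    simp only [zero_smul, add_zero] at h0
    obtain ⟨ε, hε, hdet, hpos⟩ := ((h0.eventually hint).filter_mono nhdsWithin_le_nhds |>.and
      ((eventually_det_add_smul_one_sub_one_ne_zero A).and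
        (self_mem_nhdsWithin : Set.Ioi (0 : ℝ) ∈ 𝓝[>] 0))).exists
    refine hε (isTrappedAff_of_eigenvector (lam := lam + ε) (v := w)
      (hlam.trans (le_add_of_nonneg_right (le_of_lt hpos))) ?_ (fun j => ?_) hdet)
    · rw [Matrix.add_mulVec, hAw, Matrix.smul_mulVec, Matrix.one_mulVec, add_smul]
    · have hww : 0 < w ⬝ᵥ w :=
        lt_of_le_of_ne (Finset.sum_nonneg fun i _ => mul_self_nonneg _)
          (Ne.symm (mt dotProduct_self_eq_zero.1 hw0))
      have := hB j
      have := mul_pos hpos hww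
      simp only [Matrix.add_mulVec, Matrix.smul_mulVec, Matrix.vecMulVec_mulVec, Pi.add_apply,
        Pi.smul_apply, smul_eq_mul]
      simp
      linarith
  · have hlam1 : lam = 1 := by
      have := congrFun hv (Fin.last n)
      rw [hatA_mulVec_last, Pi.smul_apply, smul_eq_mul] at this
      exact (mul_right_cancel₀ ht.ne' (by linarith : lam * v (Fin.last n) = 1 * v (Fin.last n)))
    have hcont : Continuous fun ε : ℝ => ((A, b, B, η - fun _ => ε) :
          Matrix (Fin n) (Fin n) ℝ × (Fin n → ℝ) × Matrix (Fin m) (Fin n) ℝ × (Fin m → ℝ)) := by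
      fun_prop
    have h0 := hcont.tendsto 0
    have hz : (η - fun _ => (0 : ℝ)) = η := sub_zero η
    simp only [hz] at h0
    obtain ⟨ε, hε, hpos⟩ := ((h0.eventually hint).filter_mono nhdsWithin_le_nhds |>.and
      (self_mem_nhdsWithin : Set.Ioi (0 : ℝ) ∈ 𝓝[>] 0)).exists
    refine hε (isTrappedAff_of_fixedPoint (x := (v (Fin.last n))⁻¹ • Fin.init v) ?_ fun j => ?_)
    · ext i
      have := hA i
      simp only [Matrix.mulVec_smul, Pi.add_apply, Pi.smul_apply, smul_eq_mul, Fin.init]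
      simp only [hlam1, one_mul] at this
      field_simp
      linarith
    · have h1 : η j ≤ (v (Fin.last n))⁻¹ * B.mulVec (Fin.init v) j := by
        rw [inv_mul_eq_div, le_div_iff₀ ht]
        linarith [hB j]
      have hpos' : 0 < ε := hpos
      simp only [Matrix.mulVec_smul, Pi.smul_apply, smul_eq_mul, Pi.sub_apply]
      linarith

end Homogenisation

/-- Characterisation of the robust escaping instances of the Affine Universal Escape
Problem: `(A, b, B, η)` lies in the interior of the set of escaping affine instances
iff every unit eigenvector `v̂` of `Â` for a real eigenvalue `λ ≥ 1` satisfies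
`B̂_j v̂ < 0` for some `j`. -/
theorem robust_escaping_affine_iff
    (n m : ℕ) (A : Matrix (Fin n) (Fin n) ℝ) (b : Fin n → ℝ)
    (B : Matrix (Fin m) (Fin n) ℝ) (η : Fin m → ℝ) :
    (A, b, B, η) ∈ interior {q : Matrix (Fin n) (Fin n) ℝ × (Fin n → ℝ) ×
        Matrix (Fin m) (Fin n) ℝ × (Fin m → ℝ) |
          ¬ IsTrappedAff q.1 q.2.1 q.2.2.1 q.2.2.2} ↔
      ∀ lam : ℝ, 1 ≤ lam → ∀ vh : Fin (n + 1) → ℝ, (∑ i, vh i ^ 2 = 1) →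
        (hatA A b).mulVec vh = lam • vh →
          ∃ j : Fin (m + 1), (hatB B η).mulVec vh j < 0 := by
  constructor
  · intro hint lam hlam vh hvh hev
    by_contra! hB
    refine notMem_interior_of_eigenvector hlam ?_ hev hB hint
    rintro rfl
    simp at hvh
  · intro h
    refine mem_interior.2 ⟨_, ?_,
      (isClosed_setOf_exists_eq_smul_hatA_mulVec n m).isOpen_compl, ?_⟩
    · exact fun q hq htrap => hq htrap.exists_eq_smul_hatA_mulVec
    · rintro ⟨μ, ⟨hμ0, hμ1⟩, v, hv1, hvμ, hBv⟩
      have hv0 : v ≠ 0 := by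
        rintro rfl
        simp at hv1
      have hμ : 0 < μ := by
        refine hμ0.lt_of_ne ?_
        rintro rfl
        exact hv0 (by simpa using hvμ)
      have hs : 0 < ∑ i, v i ^ 2 := by
        refine lt_of_le_of_ne (Finset.sum_nonneg fun i _ => sq_nonneg _) fun h0 => hv0 ?_
        ext i
        simpa using (Finset.sum_eq_zero_iff_of_nonneg fun i _ => sq_nonneg (v i)).1 h0.symm i
          (Finset.mem_univ i)
      set r := (Real.sqrt (∑ i, v i ^ 2))⁻¹ with hr
      have hr0 : 0 ≤ r := by positivity
      obtain ⟨j, hj⟩ := h μ⁻¹ ((one_le_inv₀ hμ).2 hμ1) (r • v)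
        (by
          simp only [Pi.smul_apply, smul_eq_mul, mul_pow, ← Finset.mul_sum]
          rw [hr, inv_pow, Real.sq_sqrt hs.le, inv_mul_cancel₀ hs.ne'])
        (by
          rw [Matrix.mulVec_smul, smul_comm]
          congr 1
          conv_rhs => rw [hvμ]
          rw [inv_smul_smul₀ hμ.ne'])
      rw [Matrix.mulVec_smul] at hj
      exact absurd hj (not_lt.2 (mul_nonneg hr0 (hBv j)))
end

section
/- The set of boundary instances of the Linear Universal Escape Problem has Lebesgue measure zero; that is, the topological frontier (boundary) of the set {(A,B) ∈ ℝ^{n×n} × ℝ^{m×n} : (A,B) is escaping} has Lebesgue measure zero in ℝ^{n×n} × ℝ^{m×n}. -/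
open MeasureTheory

noncomputable instance matrixMeasureSpace (a b : ℕ) :
    MeasureSpace (Matrix (Fin a) (Fin b) ℝ) :=
  inferInstanceAs (MeasureSpace (Fin a → Fin b → ℝ))

/-- `(A, B)` is trapped if some point of the polyhedron `P(B) = {x : B x ⊳ 0}` stays in
`P(B)` forever under iteration of `A`. -/
def IsTrapped {n m : ℕ}
    (A : Matrix (Fin n) (Fin n) ℝ) (B : Matrix (Fin m) (Fin n) ℝ) : Prop :=
  ∃ x : Fin n → ℝ, ∀ k : ℕ, ∀ j : Fin m, 0 < B.mulVec ((A ^ k).mulVec x) j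

/-- If every `x ∈ K` admits `y ∈ K` with `F y = G x` and `‖y‖ ≤ ‖x‖ / 2`, then `F - G` maps `K` onto
a set containing the image of `K` under `F`. -/
lemma PointedCone.exists_sub_apply_eq {E : Type*} [NormedAddCommGroup E] [NormedSpace ℝ E]
    [CompleteSpace E] {K : PointedCone ℝ E} (hK : IsClosed (K : Set E)) {F G : E →L[ℝ] E}
    (h : ∀ x ∈ K, ∃ y ∈ K, F y = G x ∧ ‖y‖ ≤ 1 / 2 * ‖x‖) {z : E} (hz : z ∈ K) :
    ∃ y ∈ K, F y - G y = F z := by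
  choose! r hrK hrF hrN using h
  have hu : ∀ k, r^[k] z ∈ K := fun k => by
    induction k with
    | zero => exact hz
    | succ k ih => rw [Function.iterate_succ_apply']; exact hrK _ ih
  have hn : ∀ k, ‖r^[k] z‖ ≤ (1 / 2) ^ k * ‖z‖ := fun k => by
    induction k with
    | zero => simp
    | succ k ih =>
      rw [Function.iterate_succ_apply', pow_succ']
      linarith [hrN _ (hu k)]
  have hs : Summable fun k => r^[k] z :=
    .of_norm_bounded (summable_geometric_two.mul_right ‖z‖) hn
  refine ⟨∑' k, r^[k] z, ?_, ?_⟩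
  · exact hK.mem_of_tendsto hs.hasSum (.of_forall fun s => sum_mem fun k _ => hu k)
  · rw [F.map_tsum hs, G.map_tsum hs, (F.summable hs).tsum_eq_zero_add]
    simp only [Function.iterate_succ_apply', Function.iterate_zero, id, hrF _ (hu _)]
    simp

/-- **Perron-Frobenius for cones** (finite-dimensional Krein-Rutman theorem): a linear map preserving
a nonzero closed salient cone has an eigenvector in it with nonnegative eigenvalue. -/
theorem PointedCone.exists_eigenvector {E : Type*} [NormedAddCommGroup E] [NormedSpace ℝ E]
    [FiniteDimensional ℝ E] {K : PointedCone ℝ E} (hK : IsClosed (K : Set E))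
    (hsal : ∀ y ∈ K, -y ∈ K → y = 0) {T : E →L[ℝ] E} (hT : ∀ y ∈ K, T y ∈ K)
    {x : E} (hx : x ∈ K) (hx0 : x ≠ 0) :
    ∃ l : ℝ, 0 ≤ l ∧ ∃ v ∈ K, v ≠ 0 ∧ T v = l • v := by
  by_contra! hno
  have := FiniteDimensional.complete ℝ E
  have hsmul : ∀ c : ℝ, 0 ≤ c → ∀ y ∈ K, c • y ∈ K := fun c hc y hy =>
    K.smul_mem hc hy
  set M : ℝ := 2 * ‖T‖ + 1
  have hM : 0 < M := by positivity
  obtain ⟨c, hc, hcb⟩ : ∃ c : ℝ, 0 < c ∧ ∀ t ∈ Set.Icc 0 M, ∀ y ∈ K, c * ‖y‖ ≤ ‖t • y - T y‖ := by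
    have := FiniteDimensional.proper_real E
    have hcpt : IsCompact (Set.Icc 0 M ×ˢ ((K : Set E) ∩ Metric.sphere 0 1)) :=
      isCompact_Icc.prod ((isCompact_sphere _ _).inter_left hK)
    obtain ⟨c, hc, h⟩ := hcpt.exists_forall_le' (f := fun p : ℝ × E => ‖p.1 • p.2 - T p.2‖)
      (a := 0) (by fun_prop) (by
        rintro ⟨t, y⟩ ⟨ht, hy, hy1⟩
        have hy0 : y ≠ 0 := by
          rintro rfl
          simp at hy1
        exact norm_pos_iff.2 fun h => hno t ht.1 y hy hy0 (sub_eq_zero.1 h).symm)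
    refine ⟨c, hc, fun t ht y hy => ?_⟩
    rcases eq_or_ne y 0 with rfl | hy0
    · simp
    have hpos : 0 < ‖y‖ := norm_pos_iff.2 hy0
    have := h (t, ‖y‖⁻¹ • y) ⟨ht, hsmul _ (by positivity) y hy, by simp [norm_smul, hpos.ne']⟩
    simp only [map_smul, smul_comm t, ← smul_sub, norm_smul, norm_inv, norm_norm] at this
    rwa [inv_mul_eq_div, le_div_iff₀ hpos] at this
  obtain ⟨N, hN⟩ := exists_nat_gt (2 * M / c)
  set d : ℝ := M / (N + 1)
  have hd : 0 < d := by positivity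
  have hdc : 2 * d ≤ c := by
    rw [div_lt_iff₀ hc] at hN
    simp only [d]
    rw [← mul_div_assoc, div_le_iff₀ (by positivity)]
    linarith
  have hres : ∀ k : ℕ, k ≤ N + 2 → ∀ z ∈ K, ∃ y ∈ K, (M - k * d) • y - T y = z := by
    intro k
    induction k with
    | zero =>
      intro _ z hz
      obtain ⟨y, hy, h⟩ := exists_sub_apply_eq hK (F := M • ContinuousLinearMap.id ℝ E) (G := T)
        (fun x hx => ⟨M⁻¹ • T x, hsmul _ (by positivity) _ (hT x hx), by simp [hM.ne'], by
          rw [norm_smul, norm_inv, Real.norm_of_nonneg hM.le, inv_mul_le_iff₀ hM]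
          have := T.le_opNorm x
          simp only [M]
          nlinarith [norm_nonneg x]⟩) (hsmul M⁻¹ (by positivity) z hz)
      exact ⟨y, hy, by simpa [hM.ne'] using h⟩
    | succ k ih =>
      intro hk z hz
      have ih := ih (by omega)
      have ht : M - k * d ∈ Set.Icc 0 M := by
        refine ⟨?_, by linarith [mul_nonneg k.cast_nonneg hd.le]⟩
        have : (k : ℝ) ≤ N + 1 := by exact_mod_cast (by omega : k ≤ N + 1)
        have h2 : (N + 1) * d = M := by simp only [d]; field_simp
        nlinarith
      obtain ⟨w, hw, hwz⟩ := ih z hz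
      obtain ⟨y, hy, h⟩ := exists_sub_apply_eq hK (F := (M - k * d) • ContinuousLinearMap.id ℝ E - T)
        (G := d • ContinuousLinearMap.id ℝ E) (fun x hx => by
          obtain ⟨y, hy, hyx⟩ := ih x hx
          refine ⟨d • y, hsmul d hd.le y hy, ?_, ?_⟩
          · simp [← hyx, smul_sub, smul_comm d]
          · have := hcb _ ht y hy
            rw [hyx] at this
            rw [norm_smul, Real.norm_of_nonneg hd.le]
            nlinarith [norm_nonneg y]) hw
      refine ⟨y, hy, ?_⟩
      simp only [sub_apply, smul_apply,
        ContinuousLinearMap.id_apply, hwz] at h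
      rw [← h]
      push_cast
      module
  obtain ⟨y, hy, h⟩ := hres (N + 2) le_rfl x hx
  have ht : M - ((N + 2 : ℕ) : ℝ) * d = -d := by
    simp only [d]
    push_cast
    field_simp
    ring
  rw [ht] at h
  have hny : -y ∈ K := by
    have : -y = d⁻¹ • (x + T y) := by
      rw [← h, sub_add_cancel, neg_smul, smul_neg, inv_smul_smul₀ hd.ne']
    rw [this]
    exact hsmul _ (by positivity) _ (add_mem hx (hT y hy))
  rw [hsal y hy hny] at h
  exact hx0 (by simpa using h.symm)

open scoped Pointwise in
/-- The zero set of a continuous function which is a polynomial along every line through a point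
where it does not vanish is null for Haar measure. -/
lemma addHaar_zero_of_polynomial_on_lines {E : Type*} [NormedAddCommGroup E] [NormedSpace ℝ E]
    [FiniteDimensional ℝ E] [MeasurableSpace E] [BorelSpace E] (μ : Measure E)
    [μ.IsAddHaarMeasure] {f : E → ℝ} (hf : Continuous f) {x₀ : E} (h0 : f x₀ ≠ 0)
    (hp : ∀ x, ∃ p : Polynomial ℝ, ∀ t : ℝ, f (x₀ + t • x) = p.eval t) :
    μ {x | f x = 0} = 0 := by
  have hS : MeasurableSet {q : E × ℝ | f (x₀ + q.2 • q.1) = 0} :=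
    (isClosed_eq (by fun_prop) continuous_const).measurableSet
  have hnull : (μ.prod volume) {q : E × ℝ | f (x₀ + q.2 • q.1) = 0} = 0 := by
    rw [Measure.measure_prod_null hS]
    refine .of_forall fun x => ?_
    obtain ⟨p, hp⟩ := hp x
    have hp0 : p ≠ 0 := by
      rintro rfl
      exact h0 (by simpa using hp 0)
    refine Set.Finite.measure_zero ((p.roots.toFinset.finite_toSet).subset fun t ht => ?_) _
    have : f (x₀ + t • x) = 0 := ht
    simp [hp0, ← hp, this]
  rw [← Measure.prod_swap, Measure.map_apply measurable_swap hS] at hnull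
  have hae := Measure.measure_ae_null_of_prod_null hnull
  obtain ⟨t, ht, ht0⟩ := (hae.and (Measure.ae_ne volume (0 : ℝ))).exists
  have : {x | f x = 0} = (fun x => -x₀ + x) ⁻¹' (t • {x | f (x₀ + t • x) = 0}) := by
    ext x
    simp [Set.mem_smul_set_iff_inv_smul_mem₀ ht0, ht0]
  rw [this, measure_preimage_add, Measure.addHaar_smul]
  have : μ {x | f (x₀ + t • x) = 0} = 0 := ht
  simp [this]

/-- The observability matrix of the pair `(A, b)`, whose `k`-th row is `b Aᵏ`. -/
def observabilityMatrix {R : Type*} [CommRing R] {n : ℕ} (A : Matrix (Fin n) (Fin n) R)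
    (b : Fin n → R) : Matrix (Fin n) (Fin n) R :=
  .of fun k => Matrix.vecMul b (A ^ (k : ℕ))

/-- A polynomial in the entries of `A` and `B`. If it does not vanish, `A` is invertible, its
eigenvalues are simple, and `(A, b)` is observable for every row `b` of `B`. -/
noncomputable def genericityPolynomial {R : Type*} [CommRing R] {n m : ℕ}
    (A : Matrix (Fin n) (Fin n) R) (B : Matrix (Fin m) (Fin n) R) : R :=
  A.det * (Polynomial.aeval A A.charpoly.derivative).det *
    ∏ j, (observabilityMatrix A (B j)).det

lemma observabilityMatrix_map {R S : Type*} [CommRing R] [CommRing S] (φ : R →+* S) {n : ℕ}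
    (A : Matrix (Fin n) (Fin n) R) (b : Fin n → R) :
    observabilityMatrix (A.map φ) (φ ∘ b) = (observabilityMatrix A b).map φ := by
  ext k i
  simp only [observabilityMatrix, Matrix.of_apply, Matrix.map_apply, RingHom.map_vecMul,
    Matrix.map_pow]

lemma genericityPolynomial_map {R S : Type*} [CommRing R] [CommRing S] (φ : R →+* S) {n m : ℕ}
    (A : Matrix (Fin n) (Fin n) R) (B : Matrix (Fin m) (Fin n) R) :
    genericityPolynomial (A.map φ) (B.map φ) = φ (genericityPolynomial A B) := by
  have h := Polynomial.map_aeval_eq_aeval_map (φ := φ) (ψ := φ.mapMatrix (m := Fin n))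
    (by
      ext r i j
      by_cases h : i = j <;> simp [Matrix.algebraMap_eq_diagonal, h]) A.charpoly.derivative A
  rw [← Polynomial.derivative_map, ← Matrix.charpoly_map, RingHom.mapMatrix_apply,
    RingHom.mapMatrix_apply] at h
  simp only [genericityPolynomial, map_mul, map_prod, RingHom.map_det, RingHom.mapMatrix_apply, h,
    ← observabilityMatrix_map]
  rfl

lemma continuous_genericityPolynomial {n m : ℕ} :
    Continuous fun q : Matrix (Fin n) (Fin n) ℝ × Matrix (Fin m) (Fin n) ℝ =>
      genericityPolynomial q.1 q.2 := by
  let P : MvPolynomial ((Fin n × Fin n) ⊕ (Fin m × Fin n)) ℝ :=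
    genericityPolynomial (.of fun i j => .X (.inl (i, j))) (.of fun i j => .X (.inr (i, j)))
  have h : ∀ q : Matrix (Fin n) (Fin n) ℝ × Matrix (Fin m) (Fin n) ℝ,
      genericityPolynomial q.1 q.2 =
        MvPolynomial.eval (Sum.elim (fun i => q.1 i.1 i.2) fun i => q.2 i.1 i.2) P := by
    intro q
    rw [← genericityPolynomial_map]
    congr 1 <;> ext i j <;> simp
  simp only [h]
  refine (MvPolynomial.continuous_eval P).comp (continuous_pi ?_)
  rintro (i | i)
  · exact continuous_fst.matrix_elem i.1 i.2
  · exact continuous_snd.matrix_elem i.1 i.2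

lemma exists_polynomial_genericityPolynomial {n m : ℕ} (A A' : Matrix (Fin n) (Fin n) ℝ)
    (B B' : Matrix (Fin m) (Fin n) ℝ) :
    ∃ p : Polynomial ℝ, ∀ t : ℝ,
      genericityPolynomial (A + t • A') (B + t • B') = p.eval t := by
  refine ⟨genericityPolynomial (.of fun i j => .C (A i j) + .C (A' i j) * .X)
    (.of fun i j => .C (B i j) + .C (B' i j) * .X), fun t => ?_⟩
  rw [← Polynomial.coe_evalRingHom, ← genericityPolynomial_map]
  congr 1 <;> ext i j <;> simp [mul_comm t]

lemma genericityPolynomial_diagonal_ne_zero {n m : ℕ} :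
    genericityPolynomial (Matrix.diagonal fun i : Fin n => ((i : ℕ) + 1 : ℝ))
      (.of fun (_ : Fin m) _ => 1) ≠ 0 := by
  set d : Fin n → ℝ := fun i => (i : ℕ) + 1
  have hd : Function.Injective d := fun i j h => by
    simpa [d, Fin.val_inj] using h
  refine mul_ne_zero (mul_ne_zero ?_ ?_) (Finset.prod_ne_zero_iff.2 fun j _ => ?_)
  · rw [Matrix.det_diagonal]
    exact Finset.prod_ne_zero_iff.2 fun i _ => by positivity
  · have h : Polynomial.aeval (Matrix.diagonal d) (Matrix.diagonal d).charpoly.derivative =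
        Matrix.diagonal fun i => (Matrix.diagonal d).charpoly.derivative.eval (d i) := by
      have := Polynomial.aeval_algHom_apply (Matrix.diagonalAlgHom (n := Fin n) (α := ℝ) ℝ) d
        (Matrix.diagonal d).charpoly.derivative
      simpa [Polynomial.aeval_pi_apply] using this
    rw [h, Matrix.det_diagonal, Matrix.charpoly_diagonal]
    refine Finset.prod_ne_zero_iff.2 fun i _ => ?_
    have hs := (Polynomial.separable_prod_X_sub_C_iff (f := d)).2 hd
    have := hs.eval₂_derivative_ne_zero (RingHom.id ℝ) (x := d i)
      (by
        rw [Polynomial.eval₂_id, Polynomial.eval_prod]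
        exact Finset.prod_eq_zero (Finset.mem_univ i) (by simp))
    rwa [Polynomial.eval₂_id] at this
  · have : observabilityMatrix (Matrix.diagonal d) (Matrix.of (fun (_ : Fin m) _ => (1 : ℝ)) j) =
        (Matrix.vandermonde d).transpose := by
      ext k i
      simp [observabilityMatrix, Matrix.diagonal_pow, Matrix.vecMul_diagonal, Matrix.vandermonde]
    rw [this, Matrix.det_transpose]
    exact Matrix.det_vandermonde_ne_zero_iff.2 hd

lemma volume_genericityPolynomial_eq_zero (n m : ℕ) :
    volume {q : Matrix (Fin n) (Fin n) ℝ × Matrix (Fin m) (Fin n) ℝ |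
      genericityPolynomial q.1 q.2 = 0} = 0 :=
  have (k : ℕ) : (volume : Measure (Fin k → Fin n → ℝ)).IsAddHaarMeasure :=
    Measure.pi.isAddHaarMeasure fun _ => volume
  addHaar_zero_of_polynomial_on_lines
    ((volume : Measure (Fin n → Fin n → ℝ)).prod (volume : Measure (Fin m → Fin n → ℝ)))
    (f := fun q => genericityPolynomial (n := n) (m := m) q.1 q.2) continuous_genericityPolynomial
    (x₀ := (Matrix.diagonal fun i : Fin n => ((i : ℕ) + 1 : ℝ), fun _ _ => 1))
    genericityPolynomial_diagonal_ne_zero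
    fun q => exists_polynomial_genericityPolynomial _ q.1 _ q.2

section Eigenvectors

variable {n m : ℕ} {A : Matrix (Fin n) (Fin n) ℝ} {B : Matrix (Fin m) (Fin n) ℝ}
  {b v : Fin n → ℝ} {l : ℝ}

lemma pow_mulVec_of_mulVec_eq_smul (hv : A.mulVec v = l • v) (k : ℕ) :
    (A ^ k).mulVec v = l ^ k • v := by
  induction k with
  | zero => simp
  | succ k ih => rw [pow_succ, ← Matrix.mulVec_mulVec, hv, Matrix.mulVec_smul, ih, smul_smul,
      pow_succ']

lemma observabilityMatrix_mulVec_apply (k : Fin n) :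
    (observabilityMatrix A b).mulVec v k = b ⬝ᵥ (A ^ (k : ℕ)).mulVec v :=
  (Matrix.dotProduct_mulVec b (A ^ (k : ℕ)) v).symm

lemma eq_zero_of_observable (hO : (observabilityMatrix A b).det ≠ 0)
    (h : ∀ k : ℕ, b ⬝ᵥ (A ^ k).mulVec v = 0) : v = 0 :=
  Matrix.eq_zero_of_mulVec_eq_zero hO <| funext fun k => by
    rw [observabilityMatrix_mulVec_apply, h, Pi.zero_apply]

lemma dotProduct_eigenvector_ne_zero (hO : (observabilityMatrix A b).det ≠ 0)
    (hv : A.mulVec v = l • v) (hv0 : v ≠ 0) : b ⬝ᵥ v ≠ 0 := fun h =>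
  hv0 <| eq_zero_of_observable hO fun k => by
    rw [pow_mulVec_of_mulVec_eq_smul hv, dotProduct_smul, h, smul_zero]

lemma adjugate_observabilityMatrix_mulVec_pow (hv : A.mulVec v = l • v) :
    (b ⬝ᵥ v) • (observabilityMatrix A b).adjugate.mulVec (fun k : Fin n => l ^ (k : ℕ)) =
      (observabilityMatrix A b).det • v := by
  have : (observabilityMatrix A b).mulVec v = (b ⬝ᵥ v) • fun k : Fin n => l ^ (k : ℕ) := by
    ext k
    rw [observabilityMatrix_mulVec_apply, pow_mulVec_of_mulVec_eq_smul hv]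
    simp [mul_comm]
  rw [← Matrix.mulVec_smul, ← this, Matrix.mulVec_mulVec, Matrix.adjugate_mul, Matrix.smul_mulVec,
    Matrix.one_mulVec]

lemma isTrapped_of_eigenvector (hl : 0 < l) (hv : A.mulVec v = l • v)
    (hB : ∀ j, 0 < B.mulVec v j) : IsTrapped A B :=
  ⟨v, fun k j => by
    rw [pow_mulVec_of_mulVec_eq_smul hv, Matrix.mulVec_smul]
    exact mul_pos (pow_pos hl k) (hB j)⟩

lemma genericityPolynomial_ne_zero_iff : genericityPolynomial A B ≠ 0 ↔
    A.det ≠ 0 ∧ (Polynomial.aeval A A.charpoly.derivative).det ≠ 0 ∧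
      ∀ j, (observabilityMatrix A (B j)).det ≠ 0 := by
  simp [genericityPolynomial, Finset.prod_ne_zero_iff, and_assoc]

/-- For generic pairs, an eigenvector in the closure of the polyhedron lies in the polyhedron. -/
lemma isTrapped_of_generic_of_eigenvector (hg : genericityPolynomial A B ≠ 0) (hl : 0 ≤ l)
    (hv0 : v ≠ 0) (hv : A.mulVec v = l • v) (hB : ∀ j, 0 ≤ B.mulVec v j) :
    0 < l ∧ ∀ j, 0 < B.mulVec v j := by
  obtain ⟨hdet, -, hO⟩ := genericityPolynomial_ne_zero_iff.1 hg
  refine ⟨hl.lt_of_ne ?_, fun j => (hB j).lt_of_ne' (dotProduct_eigenvector_ne_zero (hO j) hv hv0)⟩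
  rintro rfl
  exact hv0 (Matrix.eq_zero_of_mulVec_eq_zero hdet (by simpa using hv))

lemma IsTrapped.exists_eigenvector [NeZero m] (hg : genericityPolynomial A B ≠ 0)
    (h : IsTrapped A B) :
    ∃ l : ℝ, 0 ≤ l ∧ ∃ v : Fin n → ℝ, v ≠ 0 ∧ A.mulVec v = l • v ∧ ∀ j, 0 ≤ B.mulVec v j := by
  obtain ⟨-, -, hO⟩ := genericityPolynomial_ne_zero_iff.1 hg
  obtain ⟨x, hx⟩ := h
  let K : PointedCone ℝ (Fin n → ℝ) :=
    { carrier := {y | ∀ (k : ℕ) (j : Fin m), 0 ≤ B.mulVec ((A ^ k).mulVec y) j}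
      add_mem' := fun {y z} hy hz k j => by
        rw [Matrix.mulVec_add, Matrix.mulVec_add]
        exact add_nonneg (hy k j) (hz k j)
      zero_mem' := fun k j => by simp
      smul_mem' := fun c y hy k j => by
        have : c • y = (c : ℝ) • y := rfl
        rw [this, Matrix.mulVec_smul, Matrix.mulVec_smul]
        exact mul_nonneg c.2 (hy k j) }
  have hK : IsClosed (K : Set (Fin n → ℝ)) := by
    have : (K : Set (Fin n → ℝ)) =
      ⋂ (k : ℕ) (j : Fin m), {y | 0 ≤ B.mulVec ((A ^ k).mulVec y) j} := by
      ext y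
      simp only [Set.mem_iInter]
      rfl
    rw [this]
    refine isClosed_iInter fun k => isClosed_iInter fun j => isClosed_le continuous_const ?_
    fun_prop
  have hx0 : x ≠ 0 := by
    rintro rfl
    simpa using hx 0 0
  obtain ⟨l, hl, v, hvK, hv0, hv⟩ := PointedCone.exists_eigenvector hK
    (T := LinearMap.toContinuousLinearMap A.mulVecLin)
    (fun y hy hy' => eq_zero_of_observable (hO 0) fun k => le_antisymm
      (by
        have := hy' k 0
        rw [Matrix.mulVec_neg, Matrix.mulVec_neg] at this
        exact neg_nonneg.1 this) (hy k 0))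
    (fun y hy k j => by
      have := hy (k + 1) j
      rwa [pow_succ, ← Matrix.mulVec_mulVec] at this)
    (fun k j => (hx k j).le : x ∈ K) hx0
  exact ⟨l, hl, v, hv0, hv, fun j => by simpa using hvK 0 j⟩

end Eigenvectors

/-- A function vanishing with nonzero derivative at a point takes values of opposite signs at
points on both sides, in any neighbourhood. -/
lemma HasDerivAt.exists_mul_neg {g : ℝ → ℝ} {g' a : ℝ} (h : HasDerivAt g g' a) (h0 : g a = 0)
    (hg' : g' ≠ 0) {u w : ℝ} (hu : u < a) (hw : a < w) :
    ∃ s ∈ Set.Ioo u a, ∃ t ∈ Set.Ioo a w, g s * g t < 0 := by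
  have hev : ∀ᶠ t in nhdsWithin a {a}ᶜ, 0 < slope g a t * g' :=
    ((hasDerivAt_iff_tendsto_slope.1 h).mul_const g').eventually_const_lt (mul_self_pos.2 hg')
  rw [← Set.Iio_union_Ioi, nhdsWithin_union, Filter.eventually_sup] at hev
  obtain ⟨s, hs, hs'⟩ := (hev.1.and (Ioo_mem_nhdsLT hu)).exists
  obtain ⟨t, ht, ht'⟩ := (hev.2.and (Ioo_mem_nhdsGT hw)).exists
  refine ⟨s, hs', t, ht', ?_⟩
  simp only [slope_def_field, h0, sub_zero] at hs ht
  have h1 := mul_pos hs ht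
  have h2 : g s / (s - a) * g' * (g t / (t - a) * g') * ((s - a) * (t - a)) =
      g s * g t * (g' * g') := by
    have : s - a ≠ 0 := (sub_neg.2 hs'.2).ne
    have : t - a ≠ 0 := (sub_pos.2 ht'.1).ne'
    field_simp
  have h3 : (s - a) * (t - a) < 0 := mul_neg_of_neg_of_pos (sub_neg.2 hs'.2) (sub_pos.2 ht'.1)
  exact neg_of_mul_neg_left (h2 ▸ mul_neg_of_pos_of_neg h1 h3) (mul_self_nonneg g')

/-- The generic trapped pairs are interior to the set of trapped pairs. -/
lemma eventually_isTrapped {n m : ℕ} [NeZero m]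
    {p : Matrix (Fin n) (Fin n) ℝ × Matrix (Fin m) (Fin n) ℝ}
    (hg : genericityPolynomial p.1 p.2 ≠ 0) (hp : IsTrapped p.1 p.2) :
    ∀ᶠ q in nhds p, IsTrapped q.1 q.2 := by
  obtain ⟨l, hl, v, hv0, hv, hB⟩ := hp.exists_eigenvector hg
  obtain ⟨hl, hB⟩ := isTrapped_of_generic_of_eigenvector hg hl hv0 hv hB
  obtain ⟨-, hder, hO⟩ := genericityPolynomial_ne_zero_iff.1 hg
  let O (q : Matrix (Fin n) (Fin n) ℝ × Matrix (Fin m) (Fin n) ℝ) := observabilityMatrix q.1 (q.2 0)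
  let u (z : (Matrix (Fin n) (Fin n) ℝ × Matrix (Fin m) (Fin n) ℝ) × ℝ) : Fin n → ℝ :=
    (O z.1).det • (O z.1).adjugate.mulVec fun k : Fin n => z.2 ^ (k : ℕ)
  have hOc : Continuous O := by
    refine continuous_matrix fun k i => ?_
    exact (continuous_apply i).comp
      (((continuous_apply 0).comp continuous_snd).matrix_vecMul (continuous_fst.pow _))
  have huc : Continuous u :=
    (hOc.comp continuous_fst).matrix_det.smul
      ((hOc.comp continuous_fst).matrix_adjugate.matrix_mulVec (by fun_prop))
  have hup : ∀ j, 0 < p.2.mulVec (u (p, l)) j := fun j => by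
    have hpos : 0 < p.2.mulVec v 0 := hB 0
    have h := adjugate_observabilityMatrix_mulVec_pow (b := p.2 0) hv
    have h2 : p.2.mulVec v 0 • u (p, l) = ((O p).det * (O p).det) • v := by
      rw [mul_smul, ← h, smul_comm]
      rfl
    have h3 := congrArg (fun w => p.2.mulVec w j) h2
    simp only [Matrix.mulVec_smul, Pi.smul_apply, smul_eq_mul] at h3
    exact pos_of_mul_pos_right (h3 ▸ mul_pos (mul_self_pos.2 (hO 0)) (hB j)) hpos.le
  have hN : ∀ᶠ z in nhds (p, l), 0 < z.2 ∧ (O z.1).det ≠ 0 ∧ ∀ j, 0 < z.1.2.mulVec (u z) j := by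
    have hdet := (hOc.comp continuous_fst).matrix_det.tendsto (p, l)
    have hBu := (continuous_snd.comp continuous_fst).matrix_mulVec huc
    exact ((continuous_snd.tendsto (p, l)).eventually_const_lt hl).and
      ((hdet.eventually_ne (hO 0)).and (Filter.eventually_all.2 fun j =>
        (((continuous_apply j).comp hBu).tendsto (p, l)).eventually_const_lt (hup j)))
  rw [nhds_prod_eq] at hN
  obtain ⟨P, hP, Q, hQ, hPQ⟩ := Filter.eventually_prod_iff.1 hN
  obtain ⟨a, b, ⟨hal, hlb⟩, hab⟩ := mem_nhds_iff_exists_Ioo_subset.1 hQ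
  have hroot : p.1.charpoly.eval l = 0 := by
    rw [Matrix.eval_charpoly]
    refine Matrix.exists_mulVec_eq_zero_iff.1 ⟨v, hv0, ?_⟩
    rw [Matrix.sub_mulVec, hv, Matrix.scalar_apply, ← Matrix.smul_one_eq_diagonal,
      Matrix.smul_mulVec, Matrix.one_mulVec, sub_self]
  have hsimple : p.1.charpoly.derivative.eval l ≠ 0 := fun h0 => by
    refine hder (Matrix.exists_mulVec_eq_zero_iff.1 ⟨v, hv0, ?_⟩)
    rw [Polynomial.aeval_eq_sum_range, Matrix.sum_mulVec]
    simp only [Matrix.smul_mulVec, pow_mulVec_of_mulVec_eq_smul hv, smul_smul]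
    rw [← Finset.sum_smul, ← Polynomial.eval_eq_sum_range, h0, zero_smul]
  obtain ⟨s, hs, t, ht, hst⟩ :=
    (p.1.charpoly.hasDerivAt l).exists_mul_neg hroot hsimple hal hlb
  have hcont : ∀ r : ℝ, Continuous fun q : Matrix (Fin n) (Fin n) ℝ × Matrix (Fin m) (Fin n) ℝ =>
      q.1.charpoly.eval r := fun r => by
    simp only [Matrix.eval_charpoly]
    exact (continuous_const.sub continuous_fst).matrix_det
  have hsign := ((hcont s).mul (hcont t)).continuousAt.eventually_lt_const hst
  filter_upwards [hP, hsign] with q hq hsq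
  obtain ⟨r, hr, hr0⟩ : (0 : ℝ) ∈ (fun r => q.1.charpoly.eval r) '' Set.uIcc s t := by
    refine intermediate_value_uIcc (Polynomial.continuous _).continuousOn (Set.mem_uIcc.2 ?_)
    rcases mul_neg_iff.1 hsq with h | h
    · exact .inr ⟨h.2.le, h.1.le⟩
    · exact .inl ⟨h.1.le, h.2.le⟩
  rw [Set.uIcc_of_le (hs.2.trans ht.1).le] at hr
  obtain ⟨hr', hdet, hpos⟩ := hPQ hq (hab ⟨hs.1.trans_le hr.1, hr.2.trans_lt ht.2⟩)
  simp only [Matrix.eval_charpoly] at hr0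
  obtain ⟨w, hw0, hw⟩ := Matrix.exists_mulVec_eq_zero_iff.2 hr0
  rw [Matrix.sub_mulVec, Matrix.scalar_apply, ← Matrix.smul_one_eq_diagonal,
    Matrix.smul_mulVec, Matrix.one_mulVec, sub_eq_zero] at hw
  have hbw := dotProduct_eigenvector_ne_zero hdet hw.symm hw0
  have hu : u (q, r) = ((q.2 0 ⬝ᵥ w)⁻¹ * ((O q).det * (O q).det)) • w := by
    rw [mul_smul, eq_inv_smul_iff₀ hbw, mul_smul,
      ← adjugate_observabilityMatrix_mulVec_pow hw.symm, smul_comm]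
  refine isTrapped_of_eigenvector hr' ?_ hpos
  rw [hu, Matrix.mulVec_smul, ← hw, smul_comm]

/-- The generic escaping pairs are interior to the set of escaping pairs. -/
lemma eventually_not_isTrapped {n m : ℕ} [NeZero m]
    {p : Matrix (Fin n) (Fin n) ℝ × Matrix (Fin m) (Fin n) ℝ}
    (hg : genericityPolynomial p.1 p.2 ≠ 0) (hp : ¬ IsTrapped p.1 p.2) :
    ∀ᶠ q in nhds p, ¬ IsTrapped q.1 q.2 := by
  let C : Set ((Matrix (Fin n) (Fin n) ℝ × Matrix (Fin m) (Fin n) ℝ) ×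
      Metric.sphere (0 : Fin n → ℝ) 1) :=
    {z | z.1.1.mulVec z.2 = ‖z.1.1.mulVec (z.2 : Fin n → ℝ)‖ • (z.2 : Fin n → ℝ) ∧
      ∀ j, 0 ≤ z.1.2.mulVec z.2 j}
  have hC : IsClosed C := by
    have h2 : Continuous fun z : (Matrix (Fin n) (Fin n) ℝ × Matrix (Fin m) (Fin n) ℝ) ×
      Metric.sphere (0 : Fin n → ℝ) 1 => (z.2 : Fin n → ℝ) := by fun_prop
    have hA := (continuous_fst.comp continuous_fst).matrix_mulVec h2
    have hB := (continuous_snd.comp continuous_fst).matrix_mulVec h2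
    refine (isClosed_eq hA (hA.norm.smul h2)).and ?_
    simp only [Set.ofPred_forall]
    exact isClosed_iInter fun j => isClosed_le continuous_const ((continuous_apply j).comp hB)
  have hD : IsClosed (Prod.fst '' C) := isClosedMap_fst_of_compactSpace _ hC
  have hpD : p ∉ Prod.fst '' C := by
    rintro ⟨⟨_, v⟩, ⟨hv, hB⟩, rfl⟩
    have hv0 : (v : Fin n → ℝ) ≠ 0 := ne_zero_of_mem_unit_sphere v
    obtain ⟨hl, hB⟩ := isTrapped_of_generic_of_eigenvector hg (norm_nonneg _) hv0 hv hB
    exact hp (isTrapped_of_eigenvector hl hv hB)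
  filter_upwards [hD.isOpen_compl.mem_nhds hpD,
    continuous_genericityPolynomial.continuousAt.eventually_ne hg] with q hq hgq htr
  obtain ⟨l, hl, v, hv0, hv, hB⟩ := htr.exists_eigenvector hgq
  have hpos : 0 < ‖v‖ := norm_pos_iff.2 hv0
  refine hq ⟨(q, ⟨‖v‖⁻¹ • v, by simp [norm_smul, hpos.ne']⟩), ⟨?_, fun j => ?_⟩, rfl⟩
  · simp only [Matrix.mulVec_smul, hv, norm_smul, smul_smul]
    congr 1
    rw [norm_mul, norm_inv, norm_norm, Real.norm_of_nonneg hl]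
    field_simp
  · simp only [Matrix.mulVec_smul]
    exact mul_nonneg (by positivity) (hB j)

/-- The set of boundary instances of the Linear Universal Escape Problem has Lebesgue
measure zero. -/
theorem boundary_linear_escape_measure_zero (n m : ℕ) :
    volume (frontier {p : Matrix (Fin n) (Fin n) ℝ × Matrix (Fin m) (Fin n) ℝ |
      ¬ IsTrapped p.1 p.2}) = 0 := by
  rcases Nat.eq_zero_or_pos m with rfl | hm
  · have : {p : Matrix (Fin n) (Fin n) ℝ × Matrix (Fin 0) (Fin n) ℝ | ¬ IsTrapped p.1 p.2} = ∅ :=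
      Set.eq_empty_of_forall_notMem fun p hp => hp ⟨0, fun _ j => j.elim0⟩
    rw [this, frontier_empty, measure_empty]
  have : NeZero m := ⟨hm.ne'⟩
  refine measure_mono_null (fun p hp => ?_) (volume_genericityPolynomial_eq_zero n m)
  by_contra hg
  rw [frontier_eq_closure_inter_closure, Set.mem_inter_iff, mem_closure_iff_frequently,
    mem_closure_iff_frequently] at hp
  by_cases h : IsTrapped p.1 p.2
  · exact hp.1 ((eventually_isTrapped hg h).mono fun q hq hn => hn hq)
  · exact hp.2 ((eventually_not_isTrapped hg h).mono fun q hq hn => hn hq)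
end
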